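/- arXiv:1101.4328 — 4 statements merged into one kernel-verified Lean document; each statement's English description precedes it below -/
import Mathlib

section
/- Let K ≥ 2 be an integer, let a ∈ ℝ, and let z ∈ ℂ with Im z > 0. Then there exists exactly one complex number g satisfying (K/4)·g² + (z − a)·g + 1 = 0 and Im g > 0. -/
lemma existsUnique_herglotz_root {c : ℝ} (hc : 0 < c) {w : ℂ} (hw : 0 < w.im) :
    ∃! g : ℂ, (c : ℂ) * g ^ 2 + w * g + 1 = 0 ∧ 0 < g.im := by
  have hc' : (c : ℂ) ≠ 0 := by exact_mod_cast hc.ne'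
  refine existsUnique_of_exists_of_unique ?_ ?_
  · obtain ⟨s, hs⟩ := IsAlgClosed.exists_pow_nat_eq (w ^ 2 - 4 * c) (n := 2) two_pos
    obtain ⟨g, hg⟩ : ∃ g : ℂ, (c : ℂ) * g ^ 2 + w * g + 1 = 0 := by
      refine ⟨(-w + s) / (2 * c), ?_⟩
      field_simp
      linear_combination hs
    have hg0 : g ≠ 0 := by
      rintro rfl
      simp at hg
    rcases lt_trichotomy g.im 0 with h | h | h
    · refine ⟨((c : ℂ) * g)⁻¹, ?_, ?_⟩
      · field_simp
        linear_combination hg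
      · rw [Complex.inv_im, Complex.im_ofReal_mul]
        exact div_pos (neg_pos.mpr (mul_neg_of_pos_of_neg hc h))
          (Complex.normSq_pos.mpr (mul_ne_zero hc' hg0))
    · have him := congrArg Complex.im hg
      simp [pow_two, h, hw.ne'] at him
      exact absurd (Complex.ext him h) hg0
    · exact ⟨g, hg, h⟩
  · rintro g h ⟨hg, hg'⟩ ⟨hh, hh'⟩
    have hmul : (g - h) * ((c : ℂ) * (g + h) + w) = 0 := by
      linear_combination hg - hh
    rcases mul_eq_zero.mp hmul with h0 | h0
    · exact sub_eq_zero.mp h0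
    · have him := congrArg Complex.im h0
      rw [Complex.add_im, Complex.im_ofReal_mul, Complex.add_im, Complex.zero_im] at him
      have := mul_pos hc (add_pos hg' hh')
      linarith


/-- The self-consistency equation for the diagonal entry of the forward Green's
function of the free operator `(1/2)Δ + a` on the Bethe lattice with connectivity `K`:
for `Im z > 0` there is exactly one root of `(K/4)g² + (z − a)g + 1 = 0` with `Im g > 0`. -/
theorem unique_herglotz_root (K : ℕ) (hK : 2 ≤ K) (a : ℝ) (z : ℂ) (hz : 0 < z.im) :
    ∃! g : ℂ, (K : ℂ) / 4 * g ^ 2 + (z - (a : ℂ)) * g + 1 = 0 ∧ 0 < g.im := by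
  have hc : (0 : ℝ) < K / 4 := by
    have : 0 < K := by omega
    positivity
  have hw : 0 < (z - (a : ℂ)).im := by simpa using hz
  simpa using existsUnique_herglotz_root hc hw
end

section
/- Let K ≥ 2 be an integer, let E ∈ ℝ, and let a_1, …, a_m be real numbers with |E − a_k| < √K for every k; let A_E be the complex diagonal m×m matrix with entries (A_E)_{kk} = (1/(2K))·((E − a_k) − i·√(K − (E − a_k)²)). For any assignment J of a nonnegative integer J_{jk} to each pair of indices 1 ≤ j ≤ k ≤ m, set λ_J = Π_{j≤k} (4·(A_E)_{jj}·(A_E)_{kk})^{J_{jk}}. Then λ_J ≠ 1/K; equivalently, K·λ_J − 1 ≠ 0. -/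
/-- The diagonal entries of the matrix `A_E`:
`(A_E)_{kk} = (1/(2K))((E − a_k) − i√(K − (E − a_k)²))`. -/
noncomputable def AEentry (K : ℕ) (E : ℝ) (ak : ℝ) : ℂ :=
  (1 / (2 * (K : ℂ))) * (((E : ℂ) - (ak : ℂ)) -
    Complex.I * (Real.sqrt ((K : ℝ) - (E - ak) ^ 2) : ℝ))

/-- The eigenvalue `λ_J = Π_{j≤k} (4 (A_E)_{jj} (A_E)_{kk})^{J_{jk}}` of the
operator `C_E`, indexed by an assignment `J` of nonnegative integers to pairs `j ≤ k`. -/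
noncomputable def lambdaJ (K : ℕ) (E : ℝ) (m : ℕ) (a : Fin m → ℝ)
    (J : Fin m → Fin m → ℕ) : ℂ :=
  ∏ p ∈ Finset.univ.filter (fun p : Fin m × Fin m => p.1 ≤ p.2),
    (4 * AEentry K E (a p.1) * AEentry K E (a p.2)) ^ J p.1 p.2

theorem AEentry_im_neg {K : ℕ} (hK : 0 < K) {E x : ℝ} (h : |E - x| < Real.sqrt K) :
    (AEentry K E x).im < 0 := by
  have hpos : 0 < (K : ℝ) - (E - x) ^ 2 := by
    have := (Real.lt_sqrt (abs_nonneg _)).1 h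
    rw [sq_abs] at this
    linarith
  have hK' : (0 : ℝ) < K := by exact_mod_cast hK
  have hform : AEentry K E x = ((1 / (2 * (K : ℝ)) : ℝ) : ℂ) * (((E - x : ℝ) : ℂ) -
      Complex.I * (Real.sqrt ((K : ℝ) - (E - x) ^ 2) : ℝ)) := by
    simp [AEentry]
  rw [hform, Complex.im_ofReal_mul]
  have hs := Real.sqrt_pos.2 hpos
  have hc : 0 < 1 / (2 * (K : ℝ)) := by positivity
  simp only [Complex.sub_im, Complex.ofReal_im, Complex.I_mul_im, Complex.ofReal_re]
  nlinarith [mul_pos hc hs]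

theorem AEentry_norm {K : ℕ} {E x : ℝ} (h : |E - x| < Real.sqrt K) :
    ‖AEentry K E x‖ = Real.sqrt K / (2 * K) := by
  have hpos : 0 ≤ (K : ℝ) - (E - x) ^ 2 := by
    have := (Real.lt_sqrt (abs_nonneg _)).1 h
    rw [sq_abs] at this
    linarith
  have hnorm : ‖((E : ℂ) - (x : ℂ)) -
      Complex.I * (Real.sqrt ((K : ℝ) - (E - x) ^ 2) : ℝ)‖ = Real.sqrt K := by
    rw [Complex.norm_def, Complex.normSq_apply]
    congr 1
    simp only [Complex.sub_re, Complex.sub_im, Complex.ofReal_im, Complex.ofReal_re,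
      Complex.I_mul_im, Complex.I_mul_re]
    linarith [Real.mul_self_sqrt hpos]
  rw [AEentry, norm_mul, hnorm]
  simp
  ring

theorem norm_four_mul_AEentry_mul_AEentry {K : ℕ} (hK : 0 < K) {E x y : ℝ}
    (hx : |E - x| < Real.sqrt K) (hy : |E - y| < Real.sqrt K) :
    ‖4 * AEentry K E x * AEentry K E y‖ = (K : ℝ)⁻¹ := by
  have hK' : (0 : ℝ) < K := by exact_mod_cast hK
  rw [norm_mul, norm_mul, AEentry_norm hx, AEentry_norm hy, Complex.norm_ofNat]
  field_simp
  rw [Real.sq_sqrt hK'.le]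
  ring

theorem Complex.mul_ne_ofReal_of_im_neg {z w : ℂ} (hz : z.im < 0) (hw : w.im < 0) {r : ℝ}
    (hr : 0 < r) : z * w ≠ (r : ℂ) := by
  intro h
  have hre := congrArg Complex.re h
  have him := congrArg Complex.im h
  simp only [Complex.mul_re, Complex.mul_im, Complex.ofReal_re, Complex.ofReal_im] at hre him
  have key : r * z.im = -w.im * (z.re ^ 2 + z.im ^ 2) := by
    rw [← hre]
    linear_combination z.re * him
  have hleft : r * z.im < 0 := mul_neg_of_pos_of_neg hr hz
  have hright : 0 ≤ -w.im * (z.re ^ 2 + z.im ^ 2) :=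
    mul_nonneg (by linarith) (by positivity)
  linarith

theorem norm_lambdaJ {K : ℕ} (hK : 0 < K) {E : ℝ} {m : ℕ} {a : Fin m → ℝ}
    (h : ∀ k, |E - a k| < Real.sqrt K) (J : Fin m → Fin m → ℕ) :
    ‖lambdaJ K E m a J‖ =
      (K : ℝ)⁻¹ ^ ∑ p ∈ Finset.univ.filter (fun p : Fin m × Fin m => p.1 ≤ p.2), J p.1 p.2 := by
  simp_rw [lambdaJ, norm_prod, norm_pow, norm_four_mul_AEentry_mul_AEentry hK (h _) (h _),
    Finset.prod_pow_eq_pow_sum]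

theorem exists_eq_one_of_sum_eq_one {ι : Type*} {s : Finset ι} {f : ι → ℕ}
    (h : ∑ i ∈ s, f i = 1) : ∃ i ∈ s, f i = 1 ∧ ∀ j ∈ s, j ≠ i → f j = 0 := by
  classical
  obtain ⟨i, hi, hfi⟩ := Finset.exists_ne_zero_of_sum_ne_zero (h.trans_ne one_ne_zero)
  rw [← Finset.add_sum_erase s f hi] at h
  have hrest : ∑ j ∈ s.erase i, f j = 0 := by omega
  exact ⟨i, hi, by omega, fun j hj hji =>
    Finset.sum_eq_zero_iff.1 hrest j (Finset.mem_erase.2 ⟨hji, hj⟩)⟩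

theorem lambdaJ_ne_one_div {K : ℕ} (hK : 2 ≤ K) {E : ℝ} {m : ℕ} {a : Fin m → ℝ}
    (h : ∀ k, |E - a k| < Real.sqrt K) (J : Fin m → Fin m → ℕ) :
    lambdaJ K E m a J ≠ 1 / (K : ℂ) := by
  intro heq
  have hK0 : 0 < K := by omega
  have hK1 : (1 : ℝ) < K := by exact_mod_cast hK
  have hKpos : (0 : ℝ) < (K : ℝ)⁻¹ := by positivity
  have hsum : ∑ p ∈ Finset.univ.filter (fun p : Fin m × Fin m => p.1 ≤ p.2), J p.1 p.2 = 1 := by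
    have hn := norm_lambdaJ hK0 h J
    rw [heq, norm_div, norm_one, Complex.norm_natCast, one_div] at hn
    exact pow_right_injective₀ hKpos (inv_lt_one_of_one_lt₀ hK1).ne (by simpa using hn.symm)
  obtain ⟨p, hp, hJp, hother⟩ := exists_eq_one_of_sum_eq_one hsum
  have hprod : lambdaJ K E m a J = 4 * AEentry K E (a p.1) * AEentry K E (a p.2) := by
    rw [lambdaJ, Finset.prod_eq_single_of_mem p hp fun q hq hqp => by
      rw [hother q hq hqp, pow_zero], hJp, pow_one]
  refine Complex.mul_ne_ofReal_of_im_neg (AEentry_im_neg hK0 (h p.1)) (AEentry_im_neg hK0 (h p.2))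
    (r := (K : ℝ)⁻¹ / 4) (by positivity) ?_
  rw [heq] at hprod
  push_cast
  linear_combination -hprod / 4

/-- If `|E − a_k| < √K` for all `k`, then `λ_J ≠ 1/K`; equivalently `K·λ_J − 1 ≠ 0`. -/
theorem lambdaJ_ne_inv_K (K : ℕ) (hK : 2 ≤ K) (E : ℝ) (m : ℕ) (a : Fin m → ℝ)
    (h : ∀ k, |E - a k| < Real.sqrt K) (J : Fin m → Fin m → ℕ) :
    lambdaJ K E m a J ≠ 1 / (K : ℂ) ∧ (K : ℂ) * lambdaJ K E m a J - 1 ≠ 0 := by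
  have hne := lambdaJ_ne_one_div hK h J
  have hK0 : (K : ℂ) ≠ 0 := by
    exact_mod_cast (by omega : K ≠ 0)
  refine ⟨hne, fun h0 => hne ?_⟩
  rw [eq_div_iff hK0]
  linear_combination h0
end

section
/- Let B be an m×m complex symmetric matrix (Bᵀ = B) whose entrywise real part is positive definite. Then the function x ↦ exp(−xᵀBx) is integrable on ℝᵐ, its integral I(B) = ∫_{ℝᵐ} exp(−xᵀBx) dx is nonzero, and I(B)² · det B = πᵐ. -/
open MeasureTheory

/-- A real symmetric matrix is diagonalized by an orthogonal congruence. -/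
lemma Matrix.IsHermitian.exists_transpose_mul_mul_eq_diagonal {n : Type*} [Fintype n]
    [DecidableEq n] {A : Matrix n n ℝ} (hA : A.IsHermitian) :
    ∃ U : Matrix n n ℝ, U.transpose * U = 1 ∧
      U.transpose * A * U = Matrix.diagonal hA.eigenvalues := by
  refine ⟨hA.eigenvectorUnitary, ?_, ?_⟩
  · have h := Unitary.coe_star_mul_self hA.eigenvectorUnitary
    rwa [Matrix.star_eq_conjTranspose, Matrix.conjTranspose_eq_transpose_of_trivial] at h
  · have h := hA.conjStarAlgAut_star_eigenvectorUnitary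
    rw [Unitary.conjStarAlgAut_star_apply, Matrix.star_eq_conjTranspose,
      Matrix.conjTranspose_eq_transpose_of_trivial] at h
    exact h

/-- Simultaneous diagonalization by congruence of a positive definite and a symmetric real
matrix. -/
lemma Matrix.PosDef.exists_simultaneous_diagonalization {n : Type*} [Fintype n] [DecidableEq n]
    {A C : Matrix n n ℝ} (hA : A.PosDef) (hC : C.IsHermitian) :
    ∃ (M : Matrix n n ℝ) (d : n → ℝ), M.transpose * A * M = 1 ∧
      M.transpose * C * M = Matrix.diagonal d := by
  obtain ⟨U, -, hU⟩ := hA.isHermitian.exists_transpose_mul_mul_eq_diagonal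
  set D : Matrix n n ℝ := Matrix.diagonal fun i => (√(hA.isHermitian.eigenvalues i))⁻¹ with hD
  have hP : (U * D).transpose * A * (U * D) = 1 := by
    have : (U * D).transpose * A * (U * D) = D * (U.transpose * A * U) * D := by
      simp [hD, Matrix.transpose_mul, Matrix.mul_assoc]
    rw [this, hU, hD, Matrix.diagonal_mul_diagonal, Matrix.diagonal_mul_diagonal,
      ← Matrix.diagonal_one]
    congr 1
    ext i
    have hi := hA.eigenvalues_pos i
    have hs : √(hA.isHermitian.eigenvalues i) ≠ 0 := (Real.sqrt_pos.2 hi).ne'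
    field_simp
    exact (Real.sq_sqrt hi.le).symm
  have hC' : ((U * D).transpose * C * (U * D)).IsHermitian := by
    have := Matrix.isHermitian_conjTranspose_mul_mul (U * D) hC
    rwa [Matrix.conjTranspose_eq_transpose_of_trivial] at this
  obtain ⟨V, hV, hVC⟩ := hC'.exists_transpose_mul_mul_eq_diagonal
  have key (X : Matrix n n ℝ) : (U * D * V).transpose * X * (U * D * V) =
      V.transpose * ((U * D).transpose * X * (U * D)) * V := by
    simp only [Matrix.transpose_mul, Matrix.mul_assoc]
  refine ⟨U * D * V, hC'.eigenvalues, ?_, ?_⟩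
  · rw [key, hP, Matrix.mul_one, hV]
  · rw [key, hVC]

/-- The square of the one-dimensional complex Gaussian integral. -/
lemma integral_gaussian_complex_sq {b : ℂ} (hb : 0 < b.re) :
    (∫ x : ℝ, Complex.exp (-b * (x : ℂ) ^ 2)) ^ 2 = Real.pi / b := by
  rw [integral_gaussian_complex hb, ← Complex.cpow_nat_mul]
  norm_num

/-- A complex symmetric matrix with positive definite real part is congruent, through a real
invertible matrix, to a diagonal matrix whose entries have positive real part. -/
lemma exists_real_congruence_diagonal {n : Type*} [Fintype n] [DecidableEq n]
    {B : Matrix n n ℂ} (hsym : B.transpose = B)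
    (hpos : (Matrix.of fun j k => (B j k).re : Matrix n n ℝ).PosDef) :
    ∃ (M : Matrix n n ℝ) (b : n → ℂ), M.det ≠ 0 ∧ (∀ i, 0 < (b i).re) ∧
      (M.map Complex.ofRealHom).transpose * B * M.map Complex.ofRealHom = Matrix.diagonal b := by
  have hC : (Matrix.of fun j k => (B j k).im : Matrix n n ℝ).IsHermitian := by
    ext j k
    simpa using congrArg Complex.im (congrFun (congrFun hsym j) k)
  obtain ⟨M, d, hMA, hMC⟩ := hpos.exists_simultaneous_diagonalization hC
  set A : Matrix n n ℝ := Matrix.of fun j k => (B j k).re with hAdef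
  set C : Matrix n n ℝ := Matrix.of fun j k => (B j k).im with hCdef
  refine ⟨M, fun i => 1 + Complex.I * d i, fun h => ?_, fun i => by simp, ?_⟩
  · simpa [h] using congrArg Matrix.det hMA
  · have hB : B = A.map Complex.ofRealHom + Complex.I • C.map Complex.ofRealHom := by
      ext j k
      simp [hAdef, hCdef, mul_comm Complex.I, Complex.re_add_im]
    have hA' := congrArg (fun X => X.map Complex.ofRealHom) hMA
    have hC' := congrArg (fun X => X.map Complex.ofRealHom) hMC
    simp only [Matrix.map_mul, Matrix.transpose_map] at hA' hC'
    rw [hB, Matrix.mul_add, Matrix.add_mul, Matrix.mul_smul, Matrix.smul_mul, hA', hC']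
    ext j k
    rcases eq_or_ne j k with rfl | h
    · simp
    · simp [h]

/-- The complex Gaussian integral: for an `m×m` complex symmetric matrix `B` whose
entrywise real part is positive definite, `x ↦ exp(−xᵀBx)` is integrable on `ℝᵐ`,
its integral `I(B)` is nonzero, and `I(B)² · det B = πᵐ`. -/
theorem complex_gaussian_integral (m : ℕ) (B : Matrix (Fin m) (Fin m) ℂ)
    (hsym : B.transpose = B)
    (hpos : (Matrix.of fun j k => (B j k).re : Matrix (Fin m) (Fin m) ℝ).PosDef) :
    Integrable (fun x : Fin m → ℝ =>
        Complex.exp (-(∑ j, ∑ k, B j k * (x j : ℂ) * (x k : ℂ)))) ∧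
      (∫ x : Fin m → ℝ,
        Complex.exp (-(∑ j, ∑ k, B j k * (x j : ℂ) * (x k : ℂ)))) ≠ 0 ∧
      (∫ x : Fin m → ℝ,
        Complex.exp (-(∑ j, ∑ k, B j k * (x j : ℂ) * (x k : ℂ)))) ^ 2 * B.det
        = (Real.pi : ℂ) ^ m := by
  obtain ⟨M, b, hM, hb, hMB⟩ := exists_real_congruence_diagonal hsym hpos
  set f : (Fin m → ℝ) → ℂ := fun x =>
    Complex.exp (-(∑ j, ∑ k, B j k * (x j : ℂ) * (x k : ℂ))) with hf
  set T := Matrix.toLin' M with hT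
  have hfT (y : Fin m → ℝ) : f (T y) = ∏ i, Complex.exp (-b i * (y i : ℂ) ^ 2) := by
    have hquad (x : Fin m → ℝ) : ∑ j, ∑ k, B j k * (x j : ℂ) * (x k : ℂ) =
        (Complex.ofRealHom ∘ x) ⬝ᵥ B.mulVec (Complex.ofRealHom ∘ x) := by
      simp only [dotProduct, Matrix.mulVec, Finset.mul_sum]
      refine Finset.sum_congr rfl fun j _ => Finset.sum_congr rfl fun k _ => ?_
      simp only [Function.comp_apply, Complex.ofRealHom_eq_coe]
      ring
    have hTy : Complex.ofRealHom ∘ T y =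
        (M.map Complex.ofRealHom).mulVec (Complex.ofRealHom ∘ y) := by
      ext i
      exact RingHom.map_mulVec Complex.ofRealHom M y i
    rw [hf, ← Complex.exp_sum]
    dsimp only
    rw [hquad, hTy, Matrix.mulVec_mulVec, ← Matrix.vecMul_transpose,
      ← Matrix.dotProduct_mulVec, Matrix.mulVec_mulVec, ← Matrix.mul_assoc, hMB]
    congr 1
    simp only [dotProduct, Matrix.mulVec_diagonal, Function.comp_apply,
      Complex.ofRealHom_eq_coe, ← Finset.sum_neg_distrib]
    refine Finset.sum_congr rfl fun i _ => ?_
    ring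
  have hmap := Real.map_matrix_volume_pi_eq_smul_volume_pi hM
  have hemb : MeasurableEmbedding T :=
    T.continuous_of_finiteDimensional.measurableEmbedding
      (Matrix.mulVec_injective_iff_isUnit.2 ((Matrix.isUnit_iff_isUnit_det M).2 hM.isUnit))
  have hc : 0 < |M.det⁻¹| := abs_pos.2 (inv_ne_zero hM)
  have hint : Integrable f := by
    rw [← integrable_smul_measure (c := ENNReal.ofReal |M.det⁻¹|) (by simpa using hM)
      ENNReal.ofReal_ne_top, ← hmap, hemb.integrable_map_iff]
    have : f ∘ T = fun y => ∏ i, Complex.exp (-b i * (y i : ℂ) ^ 2) := funext hfT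
    rw [this]
    exact Integrable.fintype_prod fun i => integrable_cexp_neg_mul_sq (hb i)
  have hval : ((|M.det⁻¹| : ℝ) : ℂ) * ∫ x, f x =
      ∏ i, ∫ y : ℝ, Complex.exp (-b i * (y : ℂ) ^ 2) := by
    have h := hemb.integral_map (μ := volume) f
    rw [hmap, integral_smul_measure, ENNReal.toReal_ofReal hc.le, Complex.real_smul] at h
    simp_rw [hfT] at h
    rw [h, integral_fintype_prod_volume_eq_prod
      (fun i (y : ℝ) => Complex.exp (-b i * (y : ℂ) ^ 2))]
  have hdet : (M.det : ℂ) ^ 2 * B.det = ∏ i, b i := by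
    have h := congrArg Matrix.det hMB
    have hM' : (M.map Complex.ofRealHom).det = (M.det : ℂ) :=
      (RingHom.map_det Complex.ofRealHom M).symm
    rw [Matrix.det_mul, Matrix.det_mul, Matrix.det_transpose, Matrix.det_diagonal, hM'] at h
    rw [← h]
    ring
  have hsq : (∫ x, f x) ^ 2 * B.det = (Real.pi : ℂ) ^ m := by
    have hMc : (M.det : ℂ) ≠ 0 := by exact_mod_cast hM
    have hbp : ∏ i, b i ≠ 0 := Finset.prod_ne_zero_iff.2 fun i _ h => by
      simpa [h] using hb i
    have habs : ((|M.det⁻¹| : ℝ) : ℂ) ^ 2 = ((M.det : ℂ) ^ 2)⁻¹ := by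
      rw [← Complex.ofReal_pow, sq_abs]
      push_cast
      rw [inv_pow]
    have h := congrArg (fun z => z ^ 2) hval
    simp only [mul_pow, ← Finset.prod_pow, habs] at h
    simp_rw [integral_gaussian_complex_sq (hb _)] at h
    rw [Finset.prod_div_distrib, Finset.prod_const, Finset.card_univ, Fintype.card_fin,
      ← hdet] at h
    rw [← hdet] at hbp
    have hBd : B.det ≠ 0 := right_ne_zero_of_mul hbp
    field_simp at h
    exact h
  refine ⟨hint, fun h => ?_, hsq⟩
  rw [h] at hsq
  have hpi : (Real.pi : ℂ) ^ m ≠ 0 := pow_ne_zero m (by exact_mod_cast Real.pi_ne_zero)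
  exact hpi (by rw [← hsq]; simp)
end

section
/- Let B be an m×m complex symmetric matrix (Bᵀ = B) whose entrywise real part is positive definite, and let y ∈ ℂᵐ. Then x ↦ exp(−xᵀBx + yᵀx) is integrable on ℝᵐ and ∫_{ℝᵐ} exp(−xᵀBx + yᵀx) dx = exp((1/4)·yᵀB⁻¹y) · ∫_{ℝᵐ} exp(−xᵀBx) dx. -/
open MeasureTheory

namespace Matrix

variable {n : Type*} [Fintype n]

theorem sum_sum_mul_mul_eq_dotProduct_mulVec {R : Type*} [CommSemiring R] (B : Matrix n n R)
    (x : n → R) : ∑ j, ∑ k, B j k * x j * x k = x ⬝ᵥ B *ᵥ x := by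
  simp only [dotProduct, mulVec, Finset.mul_sum]
  exact Finset.sum_congr rfl fun j _ => Finset.sum_congr rfl fun k _ => by ring

theorem dotProduct_mulVec_congruence {R : Type*} [CommSemiring R] (B Q : Matrix n n R)
    (x : n → R) : (Q *ᵥ x) ⬝ᵥ B *ᵥ (Q *ᵥ x) = x ⬝ᵥ (Qᵀ * B * Q) *ᵥ x := by
  rw [← mulVec_mulVec, ← mulVec_mulVec, mulVec_transpose, dotProduct_comm x,
    ← dotProduct_mulVec, dotProduct_comm]

variable [DecidableEq n]

theorem IsHermitian.exists_transpose_mul_mul_eq_diagonal_s10 {A : Matrix n n ℝ}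
    (hA : A.IsHermitian) :
    ∃ U : Matrix n n ℝ, Uᵀ * U = 1 ∧ Uᵀ * A * U = diagonal hA.eigenvalues := by
  refine ⟨hA.eigenvectorUnitary, ?_, ?_⟩
  · have h := Unitary.coe_star_mul_self hA.eigenvectorUnitary
    rwa [star_eq_conjTranspose, conjTranspose_eq_transpose_of_trivial] at h
  · have h := hA.conjStarAlgAut_star_eigenvectorUnitary
    rw [Unitary.conjStarAlgAut_star_apply, star_eq_conjTranspose,
      conjTranspose_eq_transpose_of_trivial] at h
    exact h

/-- Simultaneous diagonalization by congruence of a positive definite and a symmetric form. -/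
theorem PosDef.exists_simultaneous_diagonalization_s10 {A C : Matrix n n ℝ} (hA : A.PosDef)
    (hC : C.IsHermitian) :
    ∃ (P : Matrix n n ℝ) (d : n → ℝ),
      P.det ≠ 0 ∧ Pᵀ * A * P = 1 ∧ Pᵀ * C * P = diagonal d := by
  obtain ⟨U, -, hUA⟩ := hA.isHermitian.exists_transpose_mul_mul_eq_diagonal_s10
  set S : Matrix n n ℝ := diagonal fun i => (√(hA.isHermitian.eigenvalues i))⁻¹ with hS
  have hQ : (U * S)ᵀ * A * (U * S) = 1 := by
    have : (U * S)ᵀ * A * (U * S) = S * (Uᵀ * A * U) * S := by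
      simp only [transpose_mul, hS, diagonal_transpose, Matrix.mul_assoc]
    rw [this, hUA, hS, diagonal_mul_diagonal, diagonal_mul_diagonal, ← diagonal_one]
    congr 1
    funext i
    have hi := hA.eigenvalues_pos i
    have hs : √(hA.isHermitian.eigenvalues i) ≠ 0 := (Real.sqrt_pos.2 hi).ne'
    field_simp
    exact (Real.sq_sqrt hi.le).symm
  have hQC : ((U * S)ᵀ * C * (U * S)).IsHermitian := by
    simpa only [conjTranspose_eq_transpose_of_trivial] using
      isHermitian_conjTranspose_mul_mul (U * S) hC
  obtain ⟨V, hV, hVC⟩ := hQC.exists_transpose_mul_mul_eq_diagonal_s10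
  have hPA : (U * S * V)ᵀ * A * (U * S * V) = 1 := by
    calc (U * S * V)ᵀ * A * (U * S * V) = Vᵀ * ((U * S)ᵀ * A * (U * S)) * V := by
          simp only [transpose_mul, Matrix.mul_assoc]
      _ = 1 := by rw [hQ, Matrix.mul_one, hV]
  refine ⟨U * S * V, hQC.eigenvalues, fun h0 => ?_, hPA, ?_⟩
  · have := congrArg det hPA
    simp only [det_mul _ (U * S * V), h0, mul_zero, det_one, zero_ne_one] at this
  · rw [← hVC]
    simp only [transpose_mul, Matrix.mul_assoc]

/-- A complex symmetric matrix with positive definite real part is diagonalized by a real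
congruence, with diagonal entries of positive real part. -/
theorem exists_real_congruence_eq_diagonal {B : Matrix n n ℂ} (hsym : Bᵀ = B)
    (hpos : (Matrix.of fun j k => (B j k).re : Matrix n n ℝ).PosDef) :
    ∃ (P : Matrix n n ℝ) (b : n → ℂ), P.det ≠ 0 ∧ (∀ i, 0 < (b i).re) ∧
      (P.map Complex.ofReal)ᵀ * B * P.map Complex.ofReal = diagonal b := by
  have hC : (B.map Complex.im).IsHermitian := by
    rw [IsHermitian, conjTranspose_eq_transpose_of_trivial, ← transpose_map, hsym]
  obtain ⟨P, d, hP, hPA, hPC⟩ := hpos.exists_simultaneous_diagonalization_s10 hC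
  refine ⟨P, fun i => ⟨1, d i⟩, hP, fun _ => one_pos, ?_⟩
  ext i j
  apply Complex.ext
  · have h := congrFun (congrFun hPA i) j
    simp only [mul_apply, transpose_apply, of_apply, one_apply] at h
    simp only [mul_apply, transpose_apply, map_apply, diagonal_apply, Complex.re_sum,
      Complex.re_mul_ofReal, Complex.re_ofReal_mul]
    rw [h]
    split_ifs <;> rfl
  · have h := congrFun (congrFun hPC i) j
    simp only [mul_apply, transpose_apply, map_apply, diagonal_apply] at h
    simp only [mul_apply, transpose_apply, map_apply, diagonal_apply, Complex.im_sum,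
      Complex.im_mul_ofReal, Complex.im_ofReal_mul]
    rw [h]
    split_ifs <;> rfl

theorem inv_eq_of_congruence_eq_diagonal {K : Type*} [Field K] {B Q : Matrix n n K} {b : n → K}
    (hb : ∀ i, b i ≠ 0) (h : Qᵀ * B * Q = diagonal b) :
    B⁻¹ = Q * diagonal (fun i => (b i)⁻¹) * Qᵀ := by
  refine inv_eq_right_inv ?_
  have h1 : Qᵀ * (B * Q * diagonal fun i => (b i)⁻¹) = 1 := by
    rw [← Matrix.mul_assoc, ← Matrix.mul_assoc, h, diagonal_mul_diagonal, ← diagonal_one]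
    congr 1
    funext i
    exact mul_inv_cancel₀ (hb i)
  simpa only [Matrix.mul_assoc] using mul_eq_one_comm.1 h1

theorem dotProduct_diagonal_mulVec {R : Type*} [CommSemiring R] (b x : n → R) :
    x ⬝ᵥ diagonal b *ᵥ x = ∑ i, b i * x i ^ 2 := by
  simp only [dotProduct, mulVec_diagonal]
  exact Finset.sum_congr rfl fun i _ => by ring

end Matrix

section LinearChangeOfVariables

variable {n E : Type*} [Fintype n] [DecidableEq n] [NormedAddCommGroup E]
  {P : Matrix n n ℝ}

theorem measurableEmbedding_toLin' (hP : P.det ≠ 0) :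
    MeasurableEmbedding (Matrix.toLin' P) :=
  (Matrix.toLin' P).continuous_of_finiteDimensional.measurableEmbedding <|
    Matrix.mulVec_injective_iff_isUnit.2 ((Matrix.isUnit_iff_isUnit_det P).2 hP.isUnit)

theorem integrable_comp_toLin'_iff (hP : P.det ≠ 0) (f : (n → ℝ) → E) :
    Integrable (fun u => f (Matrix.toLin' P u)) ↔ Integrable f := by
  rw [← Function.comp_def, ← (measurableEmbedding_toLin' hP).integrable_map_iff,
    Real.map_matrix_volume_pi_eq_smul_volume_pi hP,
    integrable_smul_measure (by simpa using hP) ENNReal.ofReal_ne_top]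

theorem integral_comp_toLin' [NormedSpace ℝ E] (hP : P.det ≠ 0) (f : (n → ℝ) → E) :
    ∫ u, f (Matrix.toLin' P u) = |P.det⁻¹| • ∫ x, f x := by
  rw [← (measurableEmbedding_toLin' hP).integral_map,
    Real.map_matrix_volume_pi_eq_smul_volume_pi hP, integral_smul_measure,
    ENNReal.toReal_ofReal (abs_nonneg _)]

end LinearChangeOfVariables

/-- Completing the square in a complex Gaussian integral: for an `m×m` complex
symmetric matrix `B` whose entrywise real part is positive definite and `y ∈ ℂᵐ`,
`x ↦ exp(−xᵀBx + yᵀx)` is integrable on `ℝᵐ` and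
`∫ exp(−xᵀBx + yᵀx) dx = exp((1/4)yᵀB⁻¹y) · ∫ exp(−xᵀBx) dx`. -/
theorem complex_gaussian_complete_square (m : ℕ) (B : Matrix (Fin m) (Fin m) ℂ)
    (hsym : B.transpose = B)
    (hpos : (Matrix.of fun j k => (B j k).re : Matrix (Fin m) (Fin m) ℝ).PosDef)
    (y : Fin m → ℂ) :
    Integrable (fun x : Fin m → ℝ =>
        Complex.exp (-(∑ j, ∑ k, B j k * (x j : ℂ) * (x k : ℂ)) + ∑ j, y j * (x j : ℂ))) ∧
      (∫ x : Fin m → ℝ,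
          Complex.exp (-(∑ j, ∑ k, B j k * (x j : ℂ) * (x k : ℂ)) + ∑ j, y j * (x j : ℂ)))
        = Complex.exp ((1 / 4 : ℂ) * ∑ j, ∑ k, y j * B⁻¹ j k * y k) *
          ∫ x : Fin m → ℝ,
            Complex.exp (-(∑ j, ∑ k, B j k * (x j : ℂ) * (x k : ℂ))) := by
  obtain ⟨P, b, hP, hb, hPB⟩ := Matrix.exists_real_congruence_eq_diagonal hsym hpos
  set Q := P.map Complex.ofReal with hQ
  have hb0 : ∀ i, b i ≠ 0 := fun i h => by simpa [h] using hb i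
  have hcast : ∀ u : Fin m → ℝ,
      (fun i => ((Matrix.toLin' P u i : ℝ) : ℂ)) = Q.mulVec fun i => (u i : ℂ) := by
    intro u
    ext i
    simp [hQ, Matrix.mulVec, dotProduct]
  have hquad : ∀ u : Fin m → ℝ,
      ∑ j, ∑ k, B j k * (Matrix.toLin' P u j : ℂ) * (Matrix.toLin' P u k : ℂ)
        = ∑ i, b i * (u i : ℂ) ^ 2 := by
    intro u
    rw [Matrix.sum_sum_mul_mul_eq_dotProduct_mulVec B fun i => (Matrix.toLin' P u i : ℂ), hcast,
      Matrix.dotProduct_mulVec_congruence, hPB, Matrix.dotProduct_diagonal_mulVec]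
  have hlin : ∀ u : Fin m → ℝ,
      ∑ j, y j * (Matrix.toLin' P u j : ℂ) = ∑ i, Q.transpose.mulVec y i * (u i : ℂ) := by
    intro u
    change dotProduct y (fun i => (Matrix.toLin' P u i : ℂ)) =
      dotProduct (Q.transpose.mulVec y) fun i => (u i : ℂ)
    rw [hcast, Matrix.dotProduct_mulVec, Matrix.mulVec_transpose]
  have hinv : ∑ j, ∑ k, y j * B⁻¹ j k * y k
      = ∑ i, (b i)⁻¹ * Q.transpose.mulVec y i ^ 2 := by
    rw [← Matrix.dotProduct_diagonal_mulVec, Matrix.dotProduct_mulVec_congruence,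
      Matrix.transpose_transpose, ← Matrix.inv_eq_of_congruence_eq_diagonal hb0 hPB,
      ← Matrix.sum_sum_mul_mul_eq_dotProduct_mulVec]
    simp only [mul_comm (y _)]
  constructor
  · rw [← integrable_comp_toLin'_iff hP]
    simp only [hquad, hlin]
    exact GaussianFourier.integrable_cexp_neg_sum_mul_add hb _
  · have hdet : |P.det⁻¹| ≠ 0 := abs_ne_zero.2 (inv_ne_zero hP)
    refine smul_right_injective ℂ hdet ?_
    simp only
    rw [← mul_smul_comm, ← integral_comp_toLin' hP, ← integral_comp_toLin' hP]
    simp only [hquad, hlin, hinv]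
    have h0 := GaussianFourier.integral_cexp_neg_sum_mul_add hb 0
    simp only [Pi.zero_apply, zero_mul, Finset.sum_const_zero, add_zero, ne_eq,
      OfNat.ofNat_ne_zero, not_false_eq_true, zero_pow, zero_div, Complex.exp_zero, mul_one] at h0
    rw [GaussianFourier.integral_cexp_neg_sum_mul_add hb, h0, Finset.prod_mul_distrib,
      ← Complex.exp_sum, mul_comm, Finset.mul_sum]
    congr 2
    refine Finset.sum_congr rfl fun i _ => ?_
    have := hb0 i
    field_simp
end
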